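/- Let ψ(z) = az + b with a, b ∈ ℂ, |a| ≤ 1, and b = 0 whenever |a| = 1, so that the composition operator C_ψ : f ↦ f∘ψ is bounded on the Fock space 𝓕₂. Then C_ψ is cyclic on 𝓕₂ if and only if a^k ≠ a for every integer k ≥ 2, and in that case every reproducing kernel K_z with z ≠ 0 is a cyclic vector for C_ψ. -/

import Mathlib

open MeasureTheory Finset

/-- Squared Fock-space norm: ‖f‖₂² = (1/π)∫_ℂ |f(z)|² e^{-|z|²} dA(z). -/
noncomputable def fockNormSq (f : ℂ → ℂ) : ℝ :=
  (1 / Real.pi) * ∫ z : ℂ, ‖f z‖ ^ 2 * Real.exp (-‖z‖ ^ 2)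

/-- Membership in the Fock space 𝓕₂: entire and square Gaussian-integrable. -/
def MemFock (f : ℂ → ℂ) : Prop :=
  Differentiable ℂ f ∧
  Integrable (fun z : ℂ => ‖f z‖ ^ 2 * Real.exp (-‖z‖ ^ 2))

/-- Fock-space inner product ⟨f,g⟩ = (1/π)∫_ℂ f(z)·conj(g(z))·e^{-|z|²} dA(z). -/
noncomputable def fockInner (f g : ℂ → ℂ) : ℂ :=
  (1 / (Real.pi : ℂ)) * ∫ z : ℂ, f z * (starRingEnd ℂ) (g z) * (Real.exp (-‖z‖ ^ 2) : ℂ)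

/-- Reproducing kernel of the Fock space: K_w(z) = e^{z·conj(w)}. -/
noncomputable def fockKernel (w : ℂ) : ℂ → ℂ :=
  fun z => Complex.exp (z * (starRingEnd ℂ) w)

/-- Weighted composition operator W_{(u,ψ)} f = u·(f∘ψ). -/
def wComp (u ψ : ℂ → ℂ) (f : ℂ → ℂ) : ℂ → ℂ := fun z => u z * f (ψ z)

/-- Composition operator C_ψ f = f∘ψ. -/
def compOp (ψ : ℂ → ℂ) (f : ℂ → ℂ) : ℂ → ℂ := fun z => f (ψ z)

/-- Multiplication operator M_u f = u·f. -/
def mulOp (u : ℂ → ℂ) (f : ℂ → ℂ) : ℂ → ℂ := fun z => u z * f z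

/-- T maps 𝓕₂ into 𝓕₂ and is bounded there. -/
def FockBoundedOp (T : (ℂ → ℂ) → ℂ → ℂ) : Prop :=
  (∀ f, MemFock f → MemFock (T f)) ∧
  ∃ C : ℝ, 0 ≤ C ∧ ∀ f, MemFock f → fockNormSq (T f) ≤ C * fockNormSq f

/-- f is a cyclic vector for T on 𝓕₂: the linear span of the orbit
{Tⁿ f : n ≥ 0} is dense in 𝓕₂. -/
def IsCyclicVec (T : (ℂ → ℂ) → ℂ → ℂ) (f : ℂ → ℂ) : Prop :=
  MemFock f ∧ ∀ g, MemFock g → ∀ ε : ℝ, 0 < ε →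
    ∃ (n : ℕ) (c : Fin n → ℂ),
      fockNormSq (fun z => (∑ i : Fin n, c i * T^[(i : ℕ)] f z) - g z) < ε

/-- T is cyclic on 𝓕₂. -/
def IsCyclicOp (T : (ℂ → ℂ) → ℂ → ℂ) : Prop := ∃ f, IsCyclicVec T f

/-- T is hypercyclic on 𝓕₂: some orbit {Tⁿ f : n ≥ 0} is dense. -/
def IsHypercyclicOp (T : (ℂ → ℂ) → ℂ → ℂ) : Prop :=
  ∃ f, MemFock f ∧ ∀ g, MemFock g → ∀ ε : ℝ, 0 < ε →
    ∃ n : ℕ, fockNormSq (fun z => T^[n] f z - g z) < ε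

/-- T is supercyclic on 𝓕₂: some projective orbit {λTⁿ f} is dense. -/
def IsSupercyclicOp (T : (ℂ → ℂ) → ℂ → ℂ) : Prop :=
  ∃ f, MemFock f ∧ ∀ g, MemFock g → ∀ ε : ℝ, 0 < ε →
    ∃ (lam : ℂ) (n : ℕ), fockNormSq (fun z => lam * T^[n] f z - g z) < ε

/-- T is invertible as a bounded operator on 𝓕₂. -/
def FockOpInvertible (T : (ℂ → ℂ) → ℂ → ℂ) : Prop :=
  (∀ f, MemFock f → MemFock (T f)) ∧
  ∃ S : (ℂ → ℂ) → ℂ → ℂ,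
    (∀ f, MemFock f → MemFock (S f)) ∧
    (∀ f, MemFock f → S (T f) = f) ∧
    (∀ f, MemFock f → T (S f) = f) ∧
    ∃ C : ℝ, 0 ≤ C ∧ ∀ f, MemFock f → fockNormSq (S f) ≤ C * fockNormSq f

/-- μ is an eigenvalue of the Hilbert-space adjoint W_{(u,ψ)}*, expressed via the
inner product: W* g = μ g for a nonzero g ∈ 𝓕₂, i.e. ⟨Wf, g⟩ = conj(μ)·⟨f, g⟩
for all f ∈ 𝓕₂. -/
def IsAdjointEigenvalue (u ψ : ℂ → ℂ) (μ : ℂ) : Prop :=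
  ∃ g, MemFock g ∧ g ≠ 0 ∧ ∀ f, MemFock f →
    fockInner (wComp u ψ f) g = (starRingEnd ℂ) μ * fockInner f g

/-- The normalised Gaussian measure `π⁻¹ e^{-|z|²} dA(z)` on `ℂ`. -/
noncomputable def fockMeasure : Measure ℂ :=
  volume.withDensity fun z => ENNReal.ofReal (Real.pi⁻¹ * Real.exp (-‖z‖ ^ 2))

theorem measurable_fockDensity :
    Measurable fun z : ℂ => ENNReal.ofReal (Real.pi⁻¹ * Real.exp (-‖z‖ ^ 2)) := by
  fun_prop

theorem toReal_fockDensity (z : ℂ) :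
    (ENNReal.ofReal (Real.pi⁻¹ * Real.exp (-‖z‖ ^ 2))).toReal =
      Real.pi⁻¹ * Real.exp (-‖z‖ ^ 2) :=
  ENNReal.toReal_ofReal (by positivity)

theorem integral_fockMeasure {E : Type*} [NormedAddCommGroup E] [NormedSpace ℝ E] (f : ℂ → E) :
    ∫ z, f z ∂fockMeasure = ∫ z, (Real.pi⁻¹ * Real.exp (-‖z‖ ^ 2)) • f z := by
  rw [fockMeasure, integral_withDensity_eq_integral_toReal_smul measurable_fockDensity
    (.of_forall fun _ => ENNReal.ofReal_lt_top)]
  simp_rw [toReal_fockDensity]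

theorem integrable_fockMeasure_iff {E : Type*} [NormedAddCommGroup E] [NormedSpace ℝ E]
    {f : ℂ → E} :
    Integrable f fockMeasure ↔
      Integrable fun z => (Real.pi⁻¹ * Real.exp (-‖z‖ ^ 2)) • f z := by
  rw [fockMeasure, integrable_withDensity_iff_integrable_smul' measurable_fockDensity
    (.of_forall fun _ => ENNReal.ofReal_lt_top)]
  simp_rw [toReal_fockDensity]

theorem integral_exp_neg_normSq : ∫ z : ℂ, Real.exp (-‖z‖ ^ 2) = Real.pi := by
  have h := GaussianFourier.integral_rexp_neg_mul_sq_norm (V := ℂ) one_pos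
  simpa using h

theorem integrable_exp_neg_normSq : Integrable fun z : ℂ => Real.exp (-‖z‖ ^ 2) :=
  .of_integral_ne_zero (by rw [integral_exp_neg_normSq]; exact Real.pi_ne_zero)

instance : IsProbabilityMeasure fockMeasure := by
  constructor
  rw [fockMeasure, withDensity_apply _ .univ, Measure.restrict_univ,
    ← ofReal_integral_eq_lintegral_ofReal (integrable_exp_neg_normSq.const_mul _)
      (.of_forall fun _ => by positivity),
    integral_const_mul, integral_exp_neg_normSq, inv_mul_cancel₀ Real.pi_ne_zero,
    ENNReal.ofReal_one]

instance : fockMeasure.IsOpenPosMeasure := by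
  have h : (volume : Measure ℂ) ≪ fockMeasure :=
    withDensity_absolutelyContinuous' measurable_fockDensity.aemeasurable
      (.of_forall fun _ => by simp [Real.pi_pos, Real.exp_pos])
  exact h.isOpenPosMeasure

theorem fockNormSq_eq_integral (f : ℂ → ℂ) :
    fockNormSq f = ∫ z, ‖f z‖ ^ 2 ∂fockMeasure := by
  rw [integral_fockMeasure, fockNormSq, ← integral_const_mul]
  congr 1 with z
  simp only [smul_eq_mul]
  ring

theorem memFock_iff {f : ℂ → ℂ} :
    MemFock f ↔ Differentiable ℂ f ∧ MemLp f 2 fockMeasure := by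
  refine and_congr_right fun hf => ?_
  rw [memLp_two_iff_integrable_sq_norm hf.continuous.aestronglyMeasurable,
    integrable_fockMeasure_iff]
  simp_rw [smul_eq_mul, mul_assoc]
  rw [integrable_const_mul_iff (IsUnit.mk0 _ (by positivity))]
  simp_rw [mul_comm]

theorem MemFock.memLp {f : ℂ → ℂ} (hf : MemFock f) : MemLp f 2 fockMeasure :=
  (memFock_iff.1 hf).2

theorem MemFock.add {f g : ℂ → ℂ} (hf : MemFock f) (hg : MemFock g) :
    MemFock fun z => f z + g z :=
  memFock_iff.2 ⟨hf.1.add hg.1, hf.memLp.add hg.memLp⟩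

theorem MemFock.sub {f g : ℂ → ℂ} (hf : MemFock f) (hg : MemFock g) :
    MemFock fun z => f z - g z :=
  memFock_iff.2 ⟨hf.1.sub hg.1, hf.memLp.sub hg.memLp⟩

theorem MemFock.const_mul {f : ℂ → ℂ} (hf : MemFock f) (c : ℂ) :
    MemFock fun z => c * f z :=
  memFock_iff.2 ⟨hf.1.const_mul c, hf.memLp.const_mul c⟩

theorem MemFock.sum {n : ℕ} {F : Fin n → ℂ → ℂ} (hF : ∀ i, MemFock (F i)) :
    MemFock fun z => ∑ i, F i z :=
  memFock_iff.2 ⟨Differentiable.fun_sum fun i _ => (hF i).1,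
    memLp_finsetSum _ fun i _ => (hF i).memLp⟩

theorem fockNormSq_eq_norm_toLp_sq {f : ℂ → ℂ} (hf : MemLp f 2 fockMeasure) :
    fockNormSq f = ‖hf.toLp f‖ ^ 2 := by
  rw [fockNormSq_eq_integral, ← @inner_self_eq_norm_sq ℂ, L2.inner_def]
  simp_rw [inner_self_eq_norm_sq_to_K]
  rw [integral_congr_ae (g := fun z => ((‖f z‖ ^ 2 : ℝ) : ℂ)) (by
    filter_upwards [hf.coeFn_toLp] with z hz
    simp [hz]), integral_complex_ofReal]
  simp

theorem differentiable_fockKernel (w : ℂ) : Differentiable ℂ (fockKernel w) := by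
  unfold fockKernel
  fun_prop

theorem norm_fockKernel_sq_mul_exp (w z : ℂ) :
    ‖fockKernel w z‖ ^ 2 * Real.exp (-‖z‖ ^ 2) =
      Real.exp (‖w‖ ^ 2) * Real.exp (-‖z - w‖ ^ 2) := by
  rw [fockKernel, Complex.norm_exp, ← Real.exp_nat_mul, ← Real.exp_add, ← Real.exp_add]
  congr 1
  simp only [Complex.sq_norm, Complex.normSq_apply, Complex.mul_re, Complex.conj_re,
    Complex.conj_im, Complex.sub_re, Complex.sub_im]
  push_cast
  ring

theorem memFock_fockKernel (w : ℂ) : MemFock (fockKernel w) := by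
  refine ⟨differentiable_fockKernel w, ?_⟩
  simp_rw [norm_fockKernel_sq_mul_exp]
  exact (integrable_exp_neg_normSq.comp_sub_right w).const_mul _

theorem fockNormSq_fockKernel (w : ℂ) : fockNormSq (fockKernel w) = Real.exp (‖w‖ ^ 2) := by
  simp_rw [fockNormSq, norm_fockKernel_sq_mul_exp]
  rw [integral_const_mul, integral_sub_right_eq_self (fun z : ℂ => Real.exp (-‖z‖ ^ 2)) w,
    integral_exp_neg_normSq]
  field_simp

/-- Rotations preserve the Gaussian measure. -/
theorem measurePreserving_mul_fockMeasure {u : ℂ} (hu : ‖u‖ = 1) :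
    MeasurePreserving (fun z => u * z) fockMeasure fockMeasure := by
  have hv : MeasurePreserving (fun z : ℂ => u * z) := by
    exact (rotation (⟨u, by simpa [Submonoid.unitSphere] using hu⟩ : Circle)).measurePreserving
  refine ⟨by fun_prop, Measure.ext fun s hs => ?_⟩
  rw [Measure.map_apply (by fun_prop) hs, fockMeasure, withDensity_apply _ hs,
    withDensity_apply _ (hv.measurable hs),
    ← hv.setLIntegral_comp_preimage hs measurable_fockDensity]
  simp [hu]

/-- The mean value property of an entire function against the Gaussian measure. -/
theorem integral_fockMeasure_of_differentiable {f : ℂ → ℂ} (hf : Differentiable ℂ f)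
    (hi : Integrable f fockMeasure) : ∫ z, f z ∂fockMeasure = f 0 := by
  have hcont := hf.continuous
  set ν : Measure ℝ := volume.restrict (Set.Ioc 0 (2 * Real.pi)) with hν
  have hu (θ : ℝ) : ‖circleMap 0 1 θ‖ = 1 := by simp
  have hrot (θ : ℝ) : ∫ z, f (circleMap 0 1 θ * z) ∂fockMeasure = ∫ z, f z ∂fockMeasure := by
    have h := measurePreserving_mul_fockMeasure (hu θ)
    rw [← integral_map h.aemeasurable hcont.aestronglyMeasurable, h.map_eq]
  have hrot' (θ : ℝ) :
      ∫ z, ‖f (circleMap 0 1 θ * z)‖ ∂fockMeasure = ∫ z, ‖f z‖ ∂fockMeasure := by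
    have h := measurePreserving_mul_fockMeasure (hu θ)
    rw [← integral_map (f := fun z => ‖f z‖) h.aemeasurable
      hcont.norm.aestronglyMeasurable, h.map_eq]
  have hprod : Integrable (fun p : ℝ × ℂ => f (circleMap 0 1 p.1 * p.2))
      (ν.prod fockMeasure) := by
    have hc : Continuous fun p : ℝ × ℂ => f (circleMap 0 1 p.1 * p.2) :=
      hcont.comp (((continuous_circleMap 0 1).comp continuous_fst).mul continuous_snd)
    rw [integrable_prod_iff hc.aestronglyMeasurable]
    refine ⟨.of_forall fun θ =>
      (measurePreserving_mul_fockMeasure (hu θ)).integrable_comp_of_integrable hi, ?_⟩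
    simp_rw [hrot']
    exact integrable_const _
  have hmean (z : ℂ) : ∫ θ, f (circleMap 0 1 θ * z) ∂ν = (2 * Real.pi) • f 0 := by
    have hd : Differentiable ℂ fun u => f (u * z) := by fun_prop
    have h := (hd.diffContOnCl (s := Metric.ball 0 |1|)).circleAverage
    rw [Real.circleAverage_def, intervalIntegral.integral_of_le Real.two_pi_pos.le,
      zero_mul] at h
    rw [← h, smul_inv_smul₀ Real.two_pi_pos.ne']
  have h := integral_integral_swap (f := fun θ z => f (circleMap 0 1 θ * z)) hprod
  simp_rw [hmean, hrot] at h
  simp only [integral_const, hν, probReal_univ, one_smul, measureReal_restrict_apply .univ,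
    Set.univ_inter, Real.volume_real_Ioc_of_le Real.two_pi_pos.le, sub_zero] at h
  exact smul_right_injective ℂ Real.two_pi_pos.ne' h

theorem conj_fockKernel (w z : ℂ) :
    starRingEnd ℂ (fockKernel w z) = Complex.exp (starRingEnd ℂ z * w) := by
  simp [fockKernel, ← Complex.exp_conj]

/-- The reproducing property of `fockKernel`. -/
theorem MemFock.integral_mul_conj_fockKernel {f : ℂ → ℂ} (hf : MemFock f) (w : ℂ) :
    ∫ z, f z * starRingEnd ℂ (fockKernel w z) ∂fockMeasure = f w := by
  have hint : Integrable (fun z => f z * starRingEnd ℂ (fockKernel w z)) fockMeasure :=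
    hf.memLp.integrable_mul (memFock_fockKernel w).memLp.star
  set G : ℂ → ℂ := fun z => (Real.pi⁻¹ * Real.exp (-‖z‖ ^ 2)) •
    (f z * starRingEnd ℂ (fockKernel w z)) with hG
  set F : ℂ → ℂ := fun z => f (z + w) * Complex.exp (-(z * starRingEnd ℂ w)) with hF
  have hFG (z : ℂ) : (Real.pi⁻¹ * Real.exp (-‖z‖ ^ 2)) • F z = G (z + w) := by
    have hexp : (Real.exp (-‖z‖ ^ 2) : ℂ) * Complex.exp (-(z * starRingEnd ℂ w)) =
        Real.exp (-‖z + w‖ ^ 2) * Complex.exp (starRingEnd ℂ (z + w) * w) := by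
      rw [Complex.ofReal_exp, Complex.ofReal_exp, ← Complex.exp_add, ← Complex.exp_add]
      congr 1
      push_cast
      rw [← Complex.conj_mul', ← Complex.conj_mul', map_add]
      ring
    simp only [hG, hF, conj_fockKernel, Complex.real_smul, Complex.ofReal_mul]
    linear_combination ((Real.pi⁻¹ : ℝ) : ℂ) * f (z + w) * hexp
  have hFd : Differentiable ℂ F := by
    have := hf.1
    fun_prop
  have hFi : Integrable F fockMeasure := by
    rw [integrable_fockMeasure_iff]
    simp_rw [hFG]
    exact (integrable_fockMeasure_iff.1 hint).comp_add_right w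
  have h := integral_fockMeasure_of_differentiable hFd hFi
  rw [integral_fockMeasure] at h ⊢
  simp_rw [hFG] at h
  rw [integral_add_right_eq_self G w] at h
  rw [h]
  simp [hF]

/-- The reproducing kernel as a vector of `L²`. -/
noncomputable def fockKernelLp (w : ℂ) : Lp ℂ 2 fockMeasure :=
  (memFock_fockKernel w).memLp.toLp

theorem inner_fockKernelLp_toLp {f : ℂ → ℂ} (hf : MemFock f) (w : ℂ) :
    inner ℂ (fockKernelLp w) (hf.memLp.toLp f) = f w := by
  rw [L2.inner_def, ← hf.integral_mul_conj_fockKernel w]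
  refine integral_congr_ae ?_
  filter_upwards [hf.memLp.coeFn_toLp, (memFock_fockKernel w).memLp.coeFn_toLp] with z h₁ h₂
  rw [h₁, fockKernelLp, h₂, RCLike.inner_apply]

theorem norm_fockKernelLp_sq (w : ℂ) : ‖fockKernelLp w‖ ^ 2 = Real.exp (‖w‖ ^ 2) := by
  rw [fockKernelLp, ← fockNormSq_eq_norm_toLp_sq, fockNormSq_fockKernel]

theorem MemFock.norm_apply_sq_le {f : ℂ → ℂ} (hf : MemFock f) (w : ℂ) :
    ‖f w‖ ^ 2 ≤ Real.exp (‖w‖ ^ 2) * fockNormSq f := by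
  rw [← norm_fockKernelLp_sq, fockNormSq_eq_norm_toLp_sq hf.memLp, ← mul_pow,
    ← inner_fockKernelLp_toLp hf]
  gcongr
  exact norm_inner_le_norm _ _

/-- The Fock space as a subspace of `L²` of the Gaussian measure. -/
noncomputable def fockSubmodule : Submodule ℂ (Lp ℂ 2 fockMeasure) where
  carrier := {x | ∃ f, ∃ hf : MemFock f, hf.memLp.toLp f = x}
  zero_mem' := ⟨fun _ => 0, ⟨differentiable_const _, by simp⟩, rfl⟩
  add_mem' := by
    rintro _ _ ⟨f, hf, rfl⟩ ⟨g, hg, rfl⟩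
    exact ⟨_, hf.add hg, rfl⟩
  smul_mem' := by
    rintro c _ ⟨f, hf, rfl⟩
    exact ⟨_, hf.const_mul c, rfl⟩

theorem isClosed_fockSubmodule : IsClosed (fockSubmodule : Set (Lp ℂ 2 fockMeasure)) := by
  refine IsSeqClosed.isClosed fun x y hx hxy => ?_
  choose f hf hfx using hx
  set F : ℂ → ℂ := fun w => inner ℂ (fockKernelLp w) y with hF
  have hfF (n : ℕ) (w : ℂ) : ‖F w - f n w‖ ≤ Real.exp (‖w‖ ^ 2 / 2) * ‖y - x n‖ := by
    have hK : ‖fockKernelLp w‖ = Real.exp (‖w‖ ^ 2 / 2) := by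
      rw [← sq_eq_sq₀ (norm_nonneg _) (Real.exp_nonneg _), norm_fockKernelLp_sq,
        ← Real.exp_nat_mul]
      congr 1
      push_cast
      ring
    rw [← inner_fockKernelLp_toLp (hf n), hfx, hF, ← inner_sub_right, ← hK]
    exact norm_inner_le_norm _ _
  have hnorm : Filter.Tendsto (fun n => ‖y - x n‖) Filter.atTop (nhds 0) := by
    simpa using ((tendsto_const_nhds (x := y)).sub hxy).norm
  have hunif : TendstoLocallyUniformly f F Filter.atTop := by
    rw [tendstoLocallyUniformly_iff_forall_isCompact]
    intro K hK
    obtain ⟨R, hR⟩ := hK.isBounded.exists_norm_le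
    rw [Metric.tendstoUniformlyOn_iff]
    intro ε hε
    have hlim := hnorm.const_mul (Real.exp (R ^ 2 / 2))
    rw [mul_zero] at hlim
    filter_upwards [hlim.eventually_lt_const hε] with n hn w hw
    rw [dist_eq_norm]
    refine (hfF n w).trans_lt (lt_of_le_of_lt ?_ hn)
    gcongr
    exact hR w hw
  have hFd : Differentiable ℂ F := by
    rw [← differentiableOn_univ]
    exact (tendstoLocallyUniformlyOn_univ.2 hunif).differentiableOn
      (.of_forall fun n => (hf n).1.differentiableOn) isOpen_univ
  obtain ⟨ns, hns, hae⟩ :=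
    (tendstoInMeasure_of_tendsto_Lp hxy).exists_seq_tendsto_ae
  have hall : ∀ᵐ z ∂fockMeasure, ∀ n, x n z = f n z :=
    ae_all_iff.2 fun n => by rw [← hfx n]; exact (hf n).memLp.coeFn_toLp
  have hyF : y =ᵐ[fockMeasure] F := by
    filter_upwards [hae, hall] with z hz hxz
    simp_rw [hxz] at hz
    exact tendsto_nhds_unique hz (((tendstoLocallyUniformlyOn_univ.2 hunif).tendsto_at
      (Set.mem_univ z)).comp hns.tendsto_atTop)
  have hFm : MemFock F := memFock_iff.2 ⟨hFd, (memLp_congr_ae hyF).1 (Lp.memLp y)⟩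
  exact ⟨F, hFm, Lp.ext (hFm.memLp.coeFn_toLp.trans hyF.symm)⟩

/-- Kernels at a bounded infinite set of points have dense linear span in the Fock space. -/
theorem toLp_mem_topologicalClosure_span_fockKernelLp {w : ℕ → ℂ} (hinj : Function.Injective w)
    (hbd : Bornology.IsBounded (Set.range w)) {g : ℂ → ℂ} (hg : MemFock g) :
    hg.memLp.toLp g ∈
      (Submodule.span ℂ (Set.range fun n => fockKernelLp (w n))).topologicalClosure := by
  set S := (Submodule.span ℂ (Set.range fun n => fockKernelLp (w n))).topologicalClosure
  have hSF : S ≤ fockSubmodule := by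
    refine Submodule.topologicalClosure_minimal _ (Submodule.span_le.2 ?_)
      isClosed_fockSubmodule
    rintro _ ⟨n, rfl⟩
    exact ⟨_, memFock_fockKernel (w n), rfl⟩
  have : CompleteSpace S :=
    IsClosed.completeSpace_coe (hs := Submodule.isClosed_topologicalClosure _)
  set x := hg.memLp.toLp g
  have hperp := S.sub_starProjection_mem_orthogonal x
  have hPS : S.starProjection x ∈ S := S.starProjection_apply_mem x
  obtain ⟨h, hh, hhx⟩ : x - S.starProjection x ∈ fockSubmodule :=
    sub_mem ⟨g, hg, rfl⟩ (hSF hPS)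
  have hzero (n : ℕ) : h (w n) = 0 := by
    rw [← inner_fockKernelLp_toLp hh, hhx]
    exact (Submodule.mem_orthogonal S _).1 hperp _
      (Submodule.le_topologicalClosure _ (Submodule.subset_span ⟨n, rfl⟩))
  obtain ⟨p, -, hp⟩ := (Set.infinite_range_of_injective hinj).exists_accPt_of_subset_isCompact
    hbd.isCompact_closure subset_closure
  have hh0 : Set.EqOn h 0 Set.univ := by
    refine AnalyticOnNhd.eqOn_zero_of_preconnected_of_frequently_eq_zero
      (fun z _ => hh.1.analyticAt z) isPreconnected_univ (Set.mem_univ p) ?_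
    refine (accPt_iff_frequently_nhdsNE.1 hp).mono ?_
    rintro _ ⟨n, rfl⟩
    exact hzero n
  have hx0 : x - S.starProjection x = 0 := by
    rw [← hhx]
    refine Lp.ext (hh.memLp.coeFn_toLp.trans ?_)
    filter_upwards [Lp.coeFn_zero ℂ 2 fockMeasure] with z hz
    rw [hz, hh0 (Set.mem_univ z)]
  rwa [← sub_eq_zero.1 hx0] at hPS

theorem isCyclicVec_of_mem_topologicalClosure {T : (ℂ → ℂ) → ℂ → ℂ} {f : ℂ → ℂ}
    (hT : ∀ i, MemFock (T^[i] f))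
    (hdense : ∀ g, ∀ hg : MemFock g, hg.memLp.toLp g ∈
      (Submodule.span ℂ (Set.range fun i => (hT i).memLp.toLp (T^[i] f))).topologicalClosure) :
    IsCyclicVec T f := by
  refine ⟨hT 0, fun g hg ε hε => ?_⟩
  obtain ⟨x, hx, hxg⟩ := Metric.mem_closure_iff.1 (hdense g hg) (√ε) (Real.sqrt_pos.2 hε)
  obtain ⟨c, rfl⟩ := Finsupp.mem_span_range_iff_exists_finsupp.1 hx
  obtain ⟨n, hn⟩ := c.support.exists_nat_subset_range
  refine ⟨n, fun i => c i, ?_⟩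
  have hsum : MemFock fun z => ∑ i : Fin n, c i * T^[(i : ℕ)] f z :=
    MemFock.sum fun i => (hT i).const_mul _
  have hLp : (hsum.sub hg).memLp.toLp =
      (c.sum fun i d => d • (hT i).memLp.toLp (T^[i] f)) - hg.memLp.toLp g := by
    rw [Finsupp.sum_of_support_subset _ hn _ (by simp),
      ← Fin.sum_univ_eq_sum_range (fun i => c i • (hT i).memLp.toLp (T^[i] f))]
    refine (MemLp.toLp_sub hsum.memLp hg.memLp).trans (congrArg (· - _) ?_)
    refine Lp.ext (hsum.memLp.coeFn_toLp.trans ?_)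
    have hterm : ∀ᵐ z ∂fockMeasure, ∀ i : Fin n,
        (c i • (hT i).memLp.toLp (T^[(i : ℕ)] f) : Lp ℂ 2 fockMeasure) z =
          c i * T^[(i : ℕ)] f z := by
      refine ae_all_iff.2 fun i => ?_
      filter_upwards [Lp.coeFn_smul (c i) ((hT i).memLp.toLp (T^[(i : ℕ)] f)),
        (hT i).memLp.coeFn_toLp] with z h₁ h₂
      rw [h₁, Pi.smul_apply, h₂, smul_eq_mul]
    filter_upwards [hterm, Lp.coeFn_finsetSum Finset.univ fun i : Fin n =>
      (c i • (hT i).memLp.toLp (T^[(i : ℕ)] f) : Lp ℂ 2 fockMeasure)] with z h₁ h₂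
    rw [h₂, Finset.sum_apply]
    exact Finset.sum_congr rfl fun i _ => (h₁ i).symm
  rw [fockNormSq_eq_norm_toLp_sq (hsum.sub hg).memLp, hLp, ← dist_eq_norm, dist_comm]
  exact (Real.lt_sqrt dist_nonneg).1 hxg

theorem iterate_compOp (ψ f : ℂ → ℂ) (n : ℕ) :
    (compOp ψ)^[n] f = fun z => f (ψ^[n] z) := by
  induction n generalizing f with
  | zero => rfl
  | succ n ih =>
    rw [Function.iterate_succ_apply, ih]
    funext z
    rw [compOp, Function.iterate_succ_apply']

theorem exists_iterate_affine (a b : ℂ) (n : ℕ) :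
    ∃ c : ℂ, ∀ z, (fun z => a * z + b)^[n] z = a ^ n * z + c := by
  induction n with
  | zero => exact ⟨0, by simp⟩
  | succ n ih =>
    obtain ⟨c, hc⟩ := ih
    refine ⟨a * c + b, fun z => ?_⟩
    rw [Function.iterate_succ_apply', hc]
    ring

theorem pow_injective_of_pow_ne_self {a : ℂ} (h : ∀ k : ℕ, 2 ≤ k → a ^ k ≠ a) :
    Function.Injective fun n : ℕ => a ^ n := by
  have ha : a ≠ 0 := fun h0 => h 2 le_rfl (by simp [h0])
  refine Function.Injective.of_lt_imp_ne fun m n hmn heq => ?_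
  have hone : a ^ (n - m) = 1 := by
    refine mul_right_cancel₀ (pow_ne_zero m ha) ?_
    rw [← pow_add, Nat.sub_add_cancel hmn.le, one_mul]
    exact heq.symm
  exact h (n - m + 1) (by omega) (by rw [pow_succ, hone, one_mul])

/-- If `a` is neither zero nor a root of unity, nontrivial kernels are cyclic vectors. -/
theorem isCyclicVec_fockKernel {a b : ℂ} (ha : ‖a‖ ≤ 1) (h : ∀ k : ℕ, 2 ≤ k → a ^ k ≠ a)
    {z : ℂ} (hz : z ≠ 0) : IsCyclicVec (compOp fun w => a * w + b) (fockKernel z) := by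
  set w : ℕ → ℂ := fun n => starRingEnd ℂ (a ^ n) * z with hw
  have horbit (n : ℕ) : ∃ c : ℂ, c ≠ 0 ∧
      (compOp fun w => a * w + b)^[n] (fockKernel z) = fun u => c * fockKernel (w n) u := by
    obtain ⟨c, hc⟩ := exists_iterate_affine a b n
    refine ⟨Complex.exp (c * starRingEnd ℂ z), Complex.exp_ne_zero _, ?_⟩
    rw [iterate_compOp]
    funext u
    rw [hc, fockKernel, fockKernel, ← Complex.exp_add]
    congr 1
    rw [hw, map_mul, Complex.conj_conj]
    ring
  have hmem (n : ℕ) : MemFock ((compOp fun w => a * w + b)^[n] (fockKernel z)) := by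
    obtain ⟨c, -, hc⟩ := horbit n
    rw [hc]
    exact (memFock_fockKernel _).const_mul c
  refine isCyclicVec_of_mem_topologicalClosure hmem fun g hg => ?_
  have hinj : Function.Injective w := fun m n hmn =>
    pow_injective_of_pow_ne_self h
      ((starRingEnd ℂ).injective (mul_right_cancel₀ hz hmn))
  have hbd : Bornology.IsBounded (Set.range w) := by
    refine isBounded_iff_forall_norm_le.2 ⟨‖z‖, ?_⟩
    rintro _ ⟨n, rfl⟩
    rw [hw, norm_mul, RCLike.norm_conj, norm_pow]
    exact mul_le_of_le_one_left (norm_nonneg _) (pow_le_one₀ (norm_nonneg _) ha)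
  refine Submodule.topologicalClosure_mono (Submodule.span_le.2 ?_)
    (toLp_mem_topologicalClosure_span_fockKernelLp hinj hbd hg)
  rintro _ ⟨n, rfl⟩
  obtain ⟨c, hc0, hc⟩ := horbit n
  have hsmul : fockKernelLp (w n) = c⁻¹ • (hmem n).memLp.toLp _ := by
    have : (hmem n).memLp.toLp _ = c • fockKernelLp (w n) := by
      simp_rw [hc]
      rfl
    rw [this, inv_smul_smul₀ hc0]
  rw [SetLike.mem_coe]
  simp only [hsmul]
  exact Submodule.smul_mem _ _ (Submodule.subset_span ⟨n, rfl⟩)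

/-- An operator whose orbits are eventually periodic is not cyclic on the Fock space. -/
theorem not_isCyclicOp_of_iterate_eq {T : (ℂ → ℂ) → ℂ → ℂ}
    (hT : ∀ f, MemFock f → MemFock (T f)) {k : ℕ}
    (hper : ∀ (f : ℂ → ℂ) (i : ℕ), ∃ j < k, T^[i] f = T^[j] f) : ¬ IsCyclicOp T := by
  rintro ⟨f, hf, hdense⟩
  have hTi (i : ℕ) : MemFock (T^[i] f) := by
    induction i with
    | zero => exact hf
    | succ i ih =>
      rw [Function.iterate_succ_apply']
      exact hT _ ih
  set v : Fin k → Fin (k + 1) → ℂ := fun i j => T^[(i : ℕ)] f (j : ℂ)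
  set W := Submodule.span ℂ (Set.range v)
  have hvW (i : ℕ) : (fun j : Fin (k + 1) => T^[i] f (j : ℂ)) ∈ W := by
    obtain ⟨j, hj, hij⟩ := hper f i
    rw [hij]
    exact Submodule.subset_span ⟨⟨j, hj⟩, rfl⟩
  have heval {g : ℂ → ℂ} (hg : MemFock g) : (fun j : Fin (k + 1) => g (j : ℂ)) ∈ W := by
    rw [← SetLike.mem_coe, ← W.closed_of_finiteDimensional.closure_eq, Metric.mem_closure_iff]
    intro ε hε
    set C := Real.exp ((k : ℝ) ^ 2) with hC
    have hCpos : 0 < C := Real.exp_pos _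
    obtain ⟨n, c, hc⟩ := hdense g hg (ε ^ 2 / C) (by positivity)
    refine ⟨fun j => ∑ i : Fin n, c i * T^[(i : ℕ)] f (j : ℂ), ?_, ?_⟩
    · have : (fun j : Fin (k + 1) => ∑ i : Fin n, c i * T^[(i : ℕ)] f (j : ℂ)) =
          ∑ i : Fin n, c i • fun j : Fin (k + 1) => T^[(i : ℕ)] f (j : ℂ) := by
        ext j
        simp
      rw [this]
      exact W.sum_mem fun i _ => W.smul_mem _ (hvW i)
    · rw [dist_comm, dist_pi_lt_iff hε]
      intro j
      have hdiff := (MemFock.sum fun i : Fin n => (hTi i).const_mul (c i)).sub hg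
      rw [dist_eq_norm, ← sq_lt_sq₀ (norm_nonneg _) hε.le]
      refine (hdiff.norm_apply_sq_le (j : ℂ)).trans_lt ?_
      have hjC : Real.exp (‖((j : ℕ) : ℂ)‖ ^ 2) ≤ C := by
        rw [hC, Complex.norm_natCast]
        gcongr
        exact Nat.lt_succ_iff.1 j.2
      calc _ ≤ C * fockNormSq _ := by
            gcongr
            rw [fockNormSq_eq_norm_toLp_sq hdiff.memLp]
            positivity
        _ < C * (ε ^ 2 / C) := by gcongr
        _ = ε ^ 2 := by field_simp
  have hli : LinearIndependent ℂ
      (Matrix.vandermonde fun i : Fin (k + 1) => Complex.exp ((i : ℕ) : ℂ)) := by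
    refine Matrix.linearIndependent_rows_of_det_ne_zero
      (Matrix.det_vandermonde_ne_zero_iff.2 fun i j hij => ?_)
    have := congrArg norm hij
    simp only [Complex.norm_exp, Complex.natCast_re, Real.exp_eq_exp, Nat.cast_inj] at this
    exact Fin.ext this
  have hsub : Submodule.span ℂ (Set.range
      (Matrix.vandermonde fun i : Fin (k + 1) => Complex.exp ((i : ℕ) : ℂ))) ≤ W := by
    refine Submodule.span_le.2 ?_
    rintro _ ⟨i, rfl⟩
    refine Set.mem_of_eq_of_mem (funext fun j => ?_)
      (heval (memFock_fockKernel ((i : ℕ) : ℂ)))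
    simp [Matrix.vandermonde, fockKernel, ← Complex.exp_nat_mul]
  have h₁ := Submodule.finrank_mono hsub
  rw [finrank_span_eq_card hli, Fintype.card_fin] at h₁
  have h₂ := finrank_range_le_card (R := ℂ) v
  rw [Fintype.card_fin] at h₂
  exact absurd (h₁.trans h₂) (by omega)

theorem iterate_affine_of_pow_eq_self {a b : ℂ} (hab : ‖a‖ = 1 → b = 0) {k : ℕ} (hk : 2 ≤ k)
    (hak : a ^ k = a) : (fun z => a * z + b)^[k] = fun z => a * z + b := by
  rcases eq_or_ne a 0 with rfl | ha
  · obtain ⟨m, rfl⟩ := Nat.exists_eq_add_of_le' hk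
    funext z
    rw [Function.iterate_succ_apply']
    simp
  · obtain ⟨m, rfl⟩ := Nat.exists_eq_add_of_le' (one_le_two.trans hk)
    have ham : a ^ m = 1 := mul_right_cancel₀ ha (by rw [← pow_succ, hak, one_mul])
    have hb : b = 0 := hab (Complex.norm_eq_one_of_pow_eq_one ham (by omega))
    subst hb
    simp only [add_zero, mul_left_iterate, hak]

theorem exists_lt_iterate_eq {α : Type*} {φ : α → α} {k : ℕ} (hk : 2 ≤ k) (h : φ^[k] = φ)
    (i : ℕ) : ∃ j < k, φ^[i] = φ^[j] := by
  induction i with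
  | zero => exact ⟨0, by omega, rfl⟩
  | succ i ih =>
    obtain ⟨j, hj, hij⟩ := ih
    have hs : φ^[i + 1] = φ^[j + 1] := by rw [Function.iterate_succ', hij, Function.iterate_succ']
    rcases Nat.lt_or_ge (j + 1) k with hlt | hge
    · exact ⟨j + 1, hlt, hs⟩
    · have hjk : j + 1 = k := by omega
      exact ⟨1, by omega, by rw [hs, hjk, h, Function.iterate_one]⟩

/-- for ψ(z) = az+b with |a| ≤ 1 and b = 0 whenever |a| = 1
(so that C_ψ is bounded on 𝓕₂), C_ψ is cyclic iff a^k ≠ a for all k ≥ 2,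
and in that case every kernel K_z with z ≠ 0 is a cyclic vector. -/
theorem composition_cyclic_iff (a b : ℂ) (ha : ‖a‖ ≤ 1)
    (hab : ‖a‖ = 1 → b = 0)
    (hbdd : FockBoundedOp (compOp (fun z => a * z + b))) :
    (IsCyclicOp (compOp (fun z => a * z + b)) ↔
      ∀ k : ℕ, 2 ≤ k → a ^ k ≠ a) ∧
    ((∀ k : ℕ, 2 ≤ k → a ^ k ≠ a) →
      ∀ z : ℂ, z ≠ 0 →
        IsCyclicVec (compOp (fun w => a * w + b)) (fockKernel z)) := by
  have hcyc (h : ∀ k : ℕ, 2 ≤ k → a ^ k ≠ a) (z : ℂ) (hz : z ≠ 0) :=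
    isCyclicVec_fockKernel (b := b) ha h hz
  refine ⟨⟨fun hop k hk hak => ?_, fun h => ⟨_, hcyc h 1 one_ne_zero⟩⟩, hcyc⟩
  refine not_isCyclicOp_of_iterate_eq hbdd.1 (k := k) (fun f i => ?_) hop
  obtain ⟨j, hj, hij⟩ :=
    exists_lt_iterate_eq hk (iterate_affine_of_pow_eq_self hab hk hak) i
  exact ⟨j, hj, by rw [iterate_compOp, iterate_compOp, hij]⟩
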